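/- Let Γ be an ATB-friendly edge-signed graph embedded in the annulus A with ATB(Γ) = 0. Let Γ_− be the subgraph of edges with interior in the lower half-plane, let Γ_+ be the subgraph of edges with interior in the upper half-plane, and let Γ_+' be the re-embedding of Γ_+ in R^2 in which the vertex labels increase from left to right. Then there is a unique pair of planar rooted binary trees (R,S) corresponding to (Γ_+', Γ_−), and Γ = Γ_A(g) for the element g = (R, S; l(v_L)) of Thompson's group T, where l(v_L) is the label of the leftmost vertex of Γ. -/

import Mathlib

/-- A planar rooted binary tree. -/
inductive PlanarBinTree : Type
  | leaf : PlanarBinTree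
  | node : PlanarBinTree → PlanarBinTree → PlanarBinTree
  deriving DecidableEq

namespace PlanarBinTree

/-- The number of leaves of a planar rooted binary tree. -/
def leaves : PlanarBinTree → ℕ
  | leaf => 1
  | node l r => l.leaves + r.leaves

end PlanarBinTree

/-- A triple `(R,S;k)` of planar rooted binary trees together with an integer `k`,
representing an element of Thompson's group `T`:  `g` sends the first interval of the
standard dyadic partition encoded by `R` to the `k`-th interval of the partition encoded
by `S`. -/
structure TTriple where
  R : PlanarBinTree
  S : PlanarBinTree
  k : ℕ

/-- The triple `(R,S;k)` genuinely represents an element of Thompson's group `T`: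
`R` and `S` have the same number `n` of leaves and `1 ≤ k ≤ n`. -/
def TTriple.Valid (g : TTriple) : Prop :=
  g.R.leaves = g.S.leaves ∧ 1 ≤ g.k ∧ g.k ≤ g.R.leaves

/-- Combinatorial model of an ATB-friendly edge-signed graph embedded in the annulus
`𝔸 = D² ∖ {0}`: all vertices lie on the `x`-axis, no loops, and each edge lies entirely in
the upper or lower half-plane.  The `N` vertices are recorded by their left-to-right
position `0, …, N-1` on the axis; `numLeft` of them (positions `0, …, numLeft - 1`) lie to
the left of the origin (the puncture), the rest to its right.  An edge is a quadruple
`(a, b, up, sign)`: `a` is the position of its left endpoint, `b` the position of its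
right (terminal) endpoint, `up = true` iff its interior lies in the upper half-plane, and
`sign = true` iff the edge is signed `+`.  An edge wraps (stretches over the origin) iff
`a < numLeft ≤ b`. -/
structure SignedAnnularGraph where
  N : ℕ
  numLeft : ℕ
  edges : Multiset (ℕ × ℕ × Bool × Bool)

namespace SignedAnnularGraph

variable (Γ : SignedAnnularGraph)

/-- Well-formedness of the combinatorial data as an ATB-friendly edge-signed graph
embedded in the annulus: there is at least one vertex, the vertex `v₁` immediately to the
right of the origin exists, every edge goes from a strictly smaller position to a strictly
larger one (in particular there are no loops), its endpoints are genuine vertices, and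
edges lying in the same half-plane are nested or disjoint (embeddedness). -/
def Wf : Prop :=
  0 < Γ.N ∧ Γ.numLeft < Γ.N ∧
    (∀ e ∈ Γ.edges, e.1 < e.2.1 ∧ e.2.1 < Γ.N) ∧
    (∀ e ∈ Γ.edges, ∀ f ∈ Γ.edges, e.2.2.1 = f.2.2.1 →
      ¬(e.1 < f.1 ∧ f.1 < e.2.1 ∧ e.2.1 < f.2.1))

/-- The label `l(v)` of the vertex at position `p`: the vertex `v₁` immediately to the
right of the origin gets label `1`, labels increase rightwards to the rightmost vertex,
then continue from the leftmost vertex `v_L` rightwards to the vertex immediately to the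
left of the origin, which gets label `N`. -/
def label (p : ℕ) : ℕ :=
  if Γ.numLeft ≤ p then p - Γ.numLeft + 1 else p + (Γ.N - Γ.numLeft) + 1

/-- `|e^in_v ∩ e^down|`: the number of lower edges whose terminal vertex is `v`. -/
def inDown (v : ℕ) : ℕ :=
  (Γ.edges.filter fun e => e.2.1 = v ∧ e.2.2.1 = false).card

/-- `|e^<_v ∩ e^up|`: the number of upper edges connecting `v` to a vertex of strictly
smaller label. -/
def ltUp (v : ℕ) : ℕ :=
  (Γ.edges.filter fun e => e.2.2.1 = true ∧
    ((e.1 = v ∧ Γ.label e.2.1 < Γ.label v) ∨ (e.2.1 = v ∧ Γ.label e.1 < Γ.label v))).card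

/-- `|e^up_-|`: the number of negative upper edges. -/
def upNeg : ℕ := (Γ.edges.filter fun e => e.2.2.1 = true ∧ e.2.2.2 = false).card

/-- `|e^down_+|`: the number of positive lower edges. -/
def downPos : ℕ := (Γ.edges.filter fun e => e.2.2.1 = false ∧ e.2.2.2 = true).card

/-- `Σ_{v ≠ v_L} |1 - |e^in_v ∩ e^down||` (the leftmost vertex `v_L` is at position `0`). -/
def sumDown : ℕ :=
  ∑ p ∈ Finset.range Γ.N, if p = 0 then 0 else (1 - (Γ.inDown p : ℤ)).natAbs

/-- `Σ_{v ≠ v₁} |1 - |e^<_v ∩ e^up||` (the vertex `v₁` immediately to the right of the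
origin is at position `numLeft`). -/
def sumUp : ℕ :=
  ∑ p ∈ Finset.range Γ.N, if p = Γ.numLeft then 0 else (1 - (Γ.ltUp p : ℤ)).natAbs

/-- Annular Thompson Badness:
`ATB(Γ) = Σ_{v ≠ v_L} |1 - |e^in_v ∩ e^down|| + Σ_{v ≠ v₁} |1 - |e^<_v ∩ e^up||
  + |e^up_-| + |e^down_+|`. -/
def ATB : ℕ := Γ.sumDown + Γ.sumUp + Γ.upNeg + Γ.downPos

end SignedAnnularGraph

/-- The edges of the graph `Γ(R)` associated to a tree `R` whose leaves are indexed
starting at `o`: one vertex immediately to the left of each leaf, and for each edge of `R`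
sloping up and to the right (i.e. each edge from a node to its left child, whose subtree
spans leaves `a, …, b`) one transversal edge of `Γ(R)` joining vertex `a` to vertex
`b + 1`. -/
def treeGraphEdges : PlanarBinTree → ℕ → Multiset (ℕ × ℕ)
  | .leaf, _ => 0
  | .node l r, o =>
      (o, o + l.leaves) ::ₘ (treeGraphEdges l o + treeGraphEdges r (o + l.leaves))

/-- The position on the axis of the vertex with (1-based) label `lab`, in an annular graph
with `N` vertices of which `numLeft` lie to the left of the origin. -/
def posOfLabel (N numLeft lab : ℕ) : ℕ :=
  if lab ≤ N - numLeft then lab + numLeft - 1 else lab - (N - numLeft) - 1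

/-- The edge-signed graph `Γ_𝔸(g)` embedded in the annulus associated to a triple
`g = (R,S;k)`: the lower part is `Γ(S)` (reflected below the axis, signed `-`), the upper
part is `Γ(R)` (signed `+`), where vertex `i` of `Γ(R)` is identified with the vertex of
label `i + 1` (so the first vertex of `Γ(R)` is the `k`-th vertex of `Γ(S)`), upper edges
attaching to the left wrapping counterclockwise around the annulus (i.e. stretching over
the origin). -/
def gammaA (g : TTriple) : SignedAnnularGraph :=
  let n := g.R.leaves
  let nl := (n - g.k + 1) % n
  { N := n
    numLeft := nl
    edges :=
      (treeGraphEdges g.S 0).map (fun e => (e.1, e.2, false, false)) +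
      (treeGraphEdges g.R 0).map (fun e =>
        (min (posOfLabel n nl (e.1 + 1)) (posOfLabel n nl (e.2 + 1)),
         max (posOfLabel n nl (e.1 + 1)) (posOfLabel n nl (e.2 + 1)), true, true)) }

/-- Reindexing of vertex positions after inserting a new vertex at position `q`. -/
def shiftIdx (q v : ℕ) : ℕ := if v < q then v else v + 1

/-- Reindexing of an edge after inserting a new vertex at position `q`. -/
def shiftEdge (q : ℕ) (e : ℕ × ℕ × Bool × Bool) : ℕ × ℕ × Bool × Bool :=
  (shiftIdx q e.1, shiftIdx q e.2.1, e.2.2)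

/-- Jones' 2-move of Type I (forward direction): adding a `1`-valent vertex together with
its edge.  The new vertex is inserted at position `q`, on the left of the origin
(`nl' = numLeft + 1`) or on its right (`nl' = numLeft`). -/
def MoveTypeI (Γ Γ' : SignedAnnularGraph) : Prop :=
  ∃ (q nl' : ℕ) (e : ℕ × ℕ × Bool × Bool),
    q ≤ Γ.N ∧ (e.1 = q ∨ e.2.1 = q) ∧ e.1 < e.2.1 ∧ e.2.1 ≤ Γ.N ∧
    ((nl' = Γ.numLeft + 1 ∧ q ≤ Γ.numLeft) ∨ (nl' = Γ.numLeft ∧ Γ.numLeft ≤ q)) ∧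
    Γ' = ⟨Γ.N + 1, nl', e ::ₘ Γ.edges.map (shiftEdge q)⟩

/-- Jones' 2-move of Type IIa (forward direction): replacing an edge by a length-two path
through a new `2`-valent vertex, the two new edges having opposite signs. -/
def MoveTypeIIa (Γ Γ' : SignedAnnularGraph) : Prop :=
  ∃ (a b : ℕ) (u s : Bool) (q : ℕ) (t : Bool) (nl' : ℕ),
    (a, b, u, s) ∈ Γ.edges ∧ a < q ∧ q ≤ b ∧
    ((nl' = Γ.numLeft + 1 ∧ q ≤ Γ.numLeft) ∨ (nl' = Γ.numLeft ∧ Γ.numLeft ≤ q)) ∧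
    Γ' = ⟨Γ.N + 1, nl',
      (a, q, u, t) ::ₘ (q, b + 1, u, !t) ::ₘ (Γ.edges.erase (a, b, u, s)).map (shiftEdge q)⟩

/-- Jones' 2-move of Type IIb (forward direction): adding a pair of parallel edges of
opposite signs between two vertices. -/
def MoveTypeIIb (Γ Γ' : SignedAnnularGraph) : Prop :=
  ∃ (a b : ℕ) (u : Bool), a < b ∧ b < Γ.N ∧
    Γ' = ⟨Γ.N, Γ.numLeft, (a, b, u, true) ::ₘ (a, b, u, false) ::ₘ Γ.edges⟩

/-- A single 2-move (any of Jones' moves of Type I, IIa, IIb, in either direction). -/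
def Move (Γ Γ' : SignedAnnularGraph) : Prop :=
  MoveTypeI Γ Γ' ∨ MoveTypeI Γ' Γ ∨ MoveTypeIIa Γ Γ' ∨ MoveTypeIIa Γ' Γ ∨
    MoveTypeIIb Γ Γ' ∨ MoveTypeIIb Γ' Γ

/-- Two edge-signed graphs embedded in the annulus are 2-equivalent if they are related by
a finite sequence of Jones' 2-moves. -/
def TwoEquiv : SignedAnnularGraph → SignedAnnularGraph → Prop :=
  Relation.ReflTransGen Move

/-- `Γ₋`: the lower part of `Γ`, i.e. the multiset of (endpoint positions of) edges whose
interiors lie in the lower half-plane. -/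
def lowerPart (Γ : SignedAnnularGraph) : Multiset (ℕ × ℕ) :=
  (Γ.edges.filter fun e => e.2.2.1 = false).map fun e => (e.1, e.2.1)

/-- `Γ₊'`: the re-embedding in `ℝ²` of the upper part `Γ₊` of `Γ` in which the vertex
labels increase from left to right; its vertices are indexed `0, …, N-1` by
`label - 1`. -/
def upperRelabeled (Γ : SignedAnnularGraph) : Multiset (ℕ × ℕ) :=
  (Γ.edges.filter fun e => e.2.2.1 = true).map fun e =>
    (min (Γ.label e.1 - 1) (Γ.label e.2.1 - 1), max (Γ.label e.1 - 1) (Γ.label e.2.1 - 1))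

theorem aux_leaves_pos (T : PlanarBinTree) : 0 < T.leaves := by
  induction T with
  | leaf => simp [PlanarBinTree.leaves]
  | node l r ihl ihr => simp only [PlanarBinTree.leaves]; omega

theorem aux_bounds (T : PlanarBinTree) : ∀ (o : ℕ), ∀ e ∈ treeGraphEdges T o,
    o ≤ e.1 ∧ e.1 < e.2 ∧ e.2 < o + T.leaves := by
  induction T with
  | leaf => intro o e he; simp [treeGraphEdges] at he
  | node l r ihl ihr =>
    intro o e he
    have hl := aux_leaves_pos l
    have hr := aux_leaves_pos r
    simp only [treeGraphEdges, Multiset.mem_cons, Multiset.mem_add] at he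
    simp only [PlanarBinTree.leaves]
    rcases he with rfl | he | he
    · simp only; omega
    · have := ihl _ _ he; omega
    · have := ihr _ _ he; omega

theorem aux_split (l r : PlanarBinTree) (o : ℕ) :
    (treeGraphEdges l o + treeGraphEdges r (o + l.leaves)).filter
      (fun e => e.2 < o + l.leaves) = treeGraphEdges l o := by
  rw [Multiset.filter_add, Multiset.filter_eq_self.2, Multiset.filter_eq_nil.2, add_zero]
  · intro e he; have := aux_bounds _ _ _ he; omega
  · intro e he; have := aux_bounds _ _ _ he; omega

theorem aux_le (l r l' r' : PlanarBinTree) (o : ℕ)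
    (h : treeGraphEdges (.node l r) o = treeGraphEdges (.node l' r') o) :
    l.leaves ≤ l'.leaves := by
  have hm : (o, o + l.leaves) ∈ treeGraphEdges (.node l' r') o := by
    rw [← h]; simp [treeGraphEdges]
  simp only [treeGraphEdges, Multiset.mem_cons, Multiset.mem_add, Prod.mk.injEq] at hm
  have := aux_leaves_pos l'
  rcases hm with hm | hm | hm
  · omega
  · have := aux_bounds _ _ _ hm; simp only at this; omega
  · have := aux_bounds _ _ _ hm; simp only at this; omega

theorem aux_inj (T : PlanarBinTree) : ∀ (T' : PlanarBinTree) (o : ℕ),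
    treeGraphEdges T o = treeGraphEdges T' o → T = T' := by
  induction T with
  | leaf =>
    intro T' o h
    cases T' with
    | leaf => rfl
    | node l r => simp [treeGraphEdges] at h
  | node l r ihl ihr =>
    intro T' o h
    cases T' with
    | leaf => simp [treeGraphEdges] at h
    | node l' r' =>
      have e1 := le_antisymm (aux_le _ _ _ _ _ h) (aux_le _ _ _ _ _ h.symm)
      simp only [treeGraphEdges] at h
      rw [e1, Multiset.cons_inj_right] at h
      have hl : treeGraphEdges l o = treeGraphEdges l' o := by
        have a1 := aux_split l r o
        have a2 := aux_split l' r' o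
        rw [e1] at a1
        rw [← a1, ← a2, h]
      rw [hl, add_right_inj] at h
      rw [ihl _ _ hl, ihr _ _ h]

theorem aux_exists (n : ℕ) : ∀ (o : ℕ) (E : Multiset (ℕ × ℕ)), 0 < n →
    (∀ e ∈ E, o ≤ e.1 ∧ e.1 < e.2 ∧ e.2 < o + n) →
    (∀ p, o < p → p < o + n → (E.filter (fun e => e.2 = p)).card = 1) →
    (∀ e ∈ E, ∀ f ∈ E, ¬ (e.1 < f.1 ∧ f.1 < e.2 ∧ e.2 < f.2)) →
    ∃ T : PlanarBinTree, T.leaves = n ∧ treeGraphEdges T o = E := by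
  induction n using Nat.strong_induction_on with
  | _ n ih =>
  intro o E hn hb hc hx
  by_cases h1 : n = 1
  · refine ⟨.leaf, by simp [PlanarBinTree.leaves, h1], ?_⟩
    simp only [treeGraphEdges]
    symm
    rw [Multiset.eq_zero_iff_forall_notMem]
    intro e he
    have := hb e he
    omega
  -- the maximal edge from `o`
  have hex : ∃ b, (o, b) ∈ E := by
    have h := hc (o+1) (by omega) (by omega)
    obtain ⟨e, he⟩ := Multiset.card_eq_one.1 h
    have hm : e ∈ E.filter (fun e => e.2 = o + 1) := by rw [he]; simp
    rw [Multiset.mem_filter] at hm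
    have := hb e hm.1
    refine ⟨o+1, ?_⟩
    have h2 : e = (o, o+1) := Prod.ext (by simp only; omega) hm.2
    rw [← h2]; exact hm.1
  obtain ⟨b, hbE, hmax⟩ : ∃ b, (o, b) ∈ E ∧ ∀ c, (o, c) ∈ E → c ≤ b := by
    classical
    have hbd : ∀ c, (o, c) ∈ E → c ≤ o + n := fun c hc' => by
      have := hb _ hc'; simp only at this; omega
    obtain ⟨b0, hb0⟩ := hex
    exact ⟨Nat.findGreatest (fun c => (o, c) ∈ E) (o+n),
      Nat.findGreatest_spec (P := fun c => (o, c) ∈ E) (hbd _ hb0) hb0,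
      fun c hc' => Nat.le_findGreatest (hbd _ hc') hc'⟩
  have hbb := hb _ hbE
  simp only at hbb
  have hR : ∀ e ∈ E, b < e.2 → b ≤ e.1 := by
    intro e he hlt
    by_contra hcon
    have h2 := hb e he
    by_cases h3 : e.1 = o
    · have := hmax e.2 (by rw [← h3]; exact he)
      omega
    · exact hx _ hbE _ he ⟨by simp only; omega, by simp only; omega, by simp only; omega⟩
  obtain ⟨l, hl, hlE⟩ := ih (b - o) (by omega) o (E.filter (fun e => e.2 < b)) (by omega)
    (by intro e he; rw [Multiset.mem_filter] at he; have := hb e he.1; omega)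
    (by
      intro p hp1 hp2
      rw [Multiset.filter_filter, ← hc p hp1 (by omega)]
      congr 1
      apply Multiset.filter_congr
      intro e _; omega)
    (by intro e he f hf; exact hx e (Multiset.mem_of_mem_filter he) f (Multiset.mem_of_mem_filter hf))
  obtain ⟨r, hr, hrE⟩ := ih (o + n - b) (by omega) b (E.filter (fun e => b < e.2)) (by omega)
    (by intro e he; rw [Multiset.mem_filter] at he
        have := hb e he.1; have := hR e he.1 he.2; omega)
    (by
      intro p hp1 hp2
      rw [Multiset.filter_filter, ← hc p (by omega) (by omega)]
      congr 1
      apply Multiset.filter_congr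
      intro e _; omega)
    (by intro e he f hf; exact hx e (Multiset.mem_of_mem_filter he) f (Multiset.mem_of_mem_filter hf))
  refine ⟨.node l r, by simp only [PlanarBinTree.leaves]; omega, ?_⟩
  have hob : o + l.leaves = b := by omega
  simp only [treeGraphEdges]
  rw [hob, hlE, hrE]
  have hs : E.filter (fun e => e.2 = b) = {(o, b)} := by
    obtain ⟨e, he⟩ := Multiset.card_eq_one.1 (hc b (by omega) (by omega))
    have hm : (o, b) ∈ E.filter (fun e => e.2 = b) := by simp [hbE]
    rw [he, Multiset.mem_singleton] at hm
    rw [he, hm]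
  have e1 := Multiset.filter_add_not (fun e : ℕ × ℕ => e.2 < b) E
  have e2 := Multiset.filter_add_not (fun e : ℕ × ℕ => e.2 = b)
    (E.filter (fun e => ¬ e.2 < b))
  rw [Multiset.filter_filter, Multiset.filter_filter] at e2
  rw [Multiset.filter_congr (q := fun e => e.2 = b) (by intro e _; omega),
    Multiset.filter_congr (p := fun e : ℕ × ℕ => ¬ e.2 = b ∧ ¬ e.2 < b) (q := fun e => b < e.2)
      (by intro e _; omega), hs] at e2
  rw [← e2] at e1
  conv_rhs => rw [← e1]
  rw [← Multiset.singleton_add]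
  abel

theorem aux_label_lt (Γ : SignedAnnularGraph) (h : Γ.numLeft < Γ.N) (p : ℕ) (hp : p < Γ.N) :
    1 ≤ Γ.label p ∧ Γ.label p ≤ Γ.N := by
  unfold SignedAnnularGraph.label; split_ifs <;> omega

theorem aux_pos_label (Γ : SignedAnnularGraph) (h : Γ.numLeft < Γ.N) (p : ℕ) (hp : p < Γ.N) :
    posOfLabel Γ.N Γ.numLeft (Γ.label p) = p := by
  unfold SignedAnnularGraph.label posOfLabel; split_ifs <;> omega

theorem aux_label_pos (Γ : SignedAnnularGraph) (h : Γ.numLeft < Γ.N) (q : ℕ) (hq : 1 ≤ q)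
    (hq' : q ≤ Γ.N) : Γ.label (posOfLabel Γ.N Γ.numLeft q) = q ∧
      posOfLabel Γ.N Γ.numLeft q < Γ.N := by
  unfold SignedAnnularGraph.label posOfLabel; split_ifs <;> omega

/-- Let `Γ` be an ATB-friendly edge-signed graph embedded in the annulus with
`ATB(Γ) = 0`, let `Γ₋` be its lower part, `Γ₊` its upper part, and `Γ₊'` the re-embedding
of `Γ₊` in `ℝ²` with vertex labels increasing from left to right.  Then there is a unique
pair of planar rooted binary trees `(R,S)` corresponding to `(Γ₊', Γ₋)`, and
`Γ = Γ_𝔸(g)` for the element `g = (R,S; l(v_L))` of Thompson's group `T`, where `l(v_L)`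
is the label of the leftmost vertex of `Γ`. -/
theorem ATB_eq_zero_unique_trees (Γ : SignedAnnularGraph) (hΓ : Γ.Wf) (h0 : Γ.ATB = 0) :
    (∃! RS : PlanarBinTree × PlanarBinTree,
      RS.1.leaves = Γ.N ∧ RS.2.leaves = Γ.N ∧
        treeGraphEdges RS.1 0 = upperRelabeled Γ ∧ treeGraphEdges RS.2 0 = lowerPart Γ) ∧
    (∀ R S : PlanarBinTree, R.leaves = Γ.N → S.leaves = Γ.N →
      treeGraphEdges R 0 = upperRelabeled Γ → treeGraphEdges S 0 = lowerPart Γ →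
      Γ = gammaA ⟨R, S, Γ.label 0⟩) := by
  obtain ⟨hN, hnl, hE, hX⟩ := hΓ
  simp only [SignedAnnularGraph.ATB, Nat.add_eq_zero_iff] at h0
  obtain ⟨⟨⟨hd, hu⟩, hun⟩, hdp⟩ := h0
  have hd' : ∀ p, 0 < p → p < Γ.N → Γ.inDown p = 1 := by
    intro p hp hp'
    have := Finset.sum_eq_zero_iff.1 hd p (Finset.mem_range.2 hp')
    rw [if_neg (by omega)] at this
    omega
  have hu' : ∀ p, p ≠ Γ.numLeft → p < Γ.N → Γ.ltUp p = 1 := by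
    intro p hp hp'
    have := Finset.sum_eq_zero_iff.1 hu p (Finset.mem_range.2 hp')
    rw [if_neg hp] at this
    omega
  have hupos : ∀ e ∈ Γ.edges, e.2.2.1 = true → e.2.2.2 = true := by
    intro e he h
    have := Multiset.filter_eq_nil.1 (Multiset.card_eq_zero.1 hun) e he
    simpa [h] using this
  have hdneg : ∀ e ∈ Γ.edges, e.2.2.1 = false → e.2.2.2 = false := by
    intro e he h
    have := Multiset.filter_eq_nil.1 (Multiset.card_eq_zero.1 hdp) e he
    simpa [h] using this
  constructor
  · obtain ⟨S, hS, hSE⟩ := aux_exists Γ.N 0 (lowerPart Γ) hN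
      (by
        intro e he
        simp only [lowerPart, Multiset.mem_map, Multiset.mem_filter] at he
        obtain ⟨f, ⟨hf, -⟩, rfl⟩ := he
        have := hE f hf
        simp only; omega)
      (by
        intro p hp hp'
        rw [← hd' p hp (by omega)]
        simp only [lowerPart, SignedAnnularGraph.inDown, Multiset.filter_map, Multiset.card_map,
          Multiset.filter_filter, Function.comp_def])
      (by
        intro e he f hf
        simp only [lowerPart, Multiset.mem_map, Multiset.mem_filter] at he hf
        obtain ⟨e, ⟨he, he2⟩, rfl⟩ := he
        obtain ⟨f, ⟨hf, hf2⟩, rfl⟩ := hf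
        exact hX e he f hf (he2.trans hf2.symm))
    obtain ⟨R, hR, hRE⟩ := aux_exists Γ.N 0 (upperRelabeled Γ) hN
      (by
        intro e he
        simp only [upperRelabeled, Multiset.mem_map, Multiset.mem_filter] at he
        obtain ⟨f, ⟨hf, -⟩, rfl⟩ := he
        have := hE f hf
        simp only [SignedAnnularGraph.label]
        split_ifs <;> omega)
      (by
        intro p hp hp'
        obtain ⟨hl, hlt⟩ := aux_label_pos Γ hnl (p+1) (by omega) (by omega)
        set q := posOfLabel Γ.N Γ.numLeft (p+1) with hq
        have hqn : q ≠ Γ.numLeft := by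
          intro h
          rw [h] at hl
          simp [SignedAnnularGraph.label] at hl
          omega
        rw [← hu' q hqn hlt]
        simp only [upperRelabeled, SignedAnnularGraph.ltUp, Multiset.filter_map,
          Multiset.card_map, Multiset.filter_filter, Function.comp_def]
        congr 1
        apply Multiset.filter_congr
        intro e he
        have h3 := hE e he
        rw [and_comm]
        apply and_congr_right
        intro _
        rw [hl]
        have a1 := aux_label_lt Γ hnl e.1 (by omega)
        have a2 := aux_label_lt Γ hnl e.2.1 (by omega)
        have b1 := aux_pos_label Γ hnl e.1 (by omega)
        have b2 := aux_pos_label Γ hnl e.2.1 (by omega)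
        have c1 : e.1 = q ↔ Γ.label e.1 = p + 1 :=
          ⟨fun h => by rw [h, hl], fun h => by rw [← b1, h]⟩
        have c2 : e.2.1 = q ↔ Γ.label e.2.1 = p + 1 :=
          ⟨fun h => by rw [h, hl], fun h => by rw [← b2, h]⟩
        have c3 : Γ.label e.1 ≠ Γ.label e.2.1 := by
          intro h; rw [h, b2] at b1; omega
        rw [c1, c2]
        omega)
      (by
        intro e he f hf
        simp only [upperRelabeled, Multiset.mem_map, Multiset.mem_filter] at he hf
        obtain ⟨e, ⟨he, he2⟩, rfl⟩ := he
        obtain ⟨f, ⟨hf, hf2⟩, rfl⟩ := hf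
        have x1 := hX e he f hf (he2.trans hf2.symm)
        have x2 := hX f hf e he (hf2.trans he2.symm)
        have y1 := hE e he
        have y2 := hE f hf
        simp only [SignedAnnularGraph.label]
        split_ifs <;> omega)
    refine ⟨(R, S), ⟨hR, hS, hRE, hSE⟩, ?_⟩
    rintro ⟨R', S'⟩ ⟨-, -, h1, h2⟩
    simp only at h1 h2
    rw [aux_inj R' R 0 (h1.trans hRE.symm), aux_inj S' S 0 (h2.trans hSE.symm)]
  · intro R S hR hS hRE hSE
    have hk : (Γ.N - Γ.label 0 + 1) % Γ.N = Γ.numLeft := by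
      by_cases h : Γ.numLeft = 0
      · have : Γ.label 0 = 1 := by simp [SignedAnnularGraph.label, h]
        rw [this, h, Nat.sub_add_cancel hN, Nat.mod_self]
      · have : Γ.N - Γ.label 0 + 1 = Γ.numLeft := by
          simp only [SignedAnnularGraph.label]; split_ifs <;> omega
        rw [this, Nat.mod_eq_of_lt hnl]
    have hedges : Γ.edges =
        (lowerPart Γ).map (fun e => (e.1, e.2, false, false)) +
        (upperRelabeled Γ).map (fun e =>
        (min (posOfLabel Γ.N Γ.numLeft (e.1 + 1)) (posOfLabel Γ.N Γ.numLeft (e.2 + 1)),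
         max (posOfLabel Γ.N Γ.numLeft (e.1 + 1)) (posOfLabel Γ.N Γ.numLeft (e.2 + 1)),
         true, true)) := by
      conv_lhs => rw [← Multiset.filter_add_not (fun e => e.2.2.1 = false) Γ.edges]
      congr 1
      · rw [lowerPart, Multiset.map_map]
        conv_lhs => rw [← Multiset.map_id (Multiset.filter _ _)]
        apply Multiset.map_congr rfl
        intro e he
        rw [Multiset.mem_filter] at he
        have h1 := hdneg e he.1 he.2
        obtain ⟨a, b, u, s⟩ := e
        simp only at he h1
        simp [he.2, h1]
      · rw [upperRelabeled, Multiset.map_map]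
        conv_lhs => rw [← Multiset.map_id (Multiset.filter _ _)]
        apply Multiset.map_congr
        · apply Multiset.filter_congr
          intro e _; simp
        intro e he
        rw [Multiset.mem_filter] at he
        have hu1 : e.2.2.1 = true := by simpa using he.2
        have h1 := hupos e he.1 hu1
        have h3 := hE e he.1
        have a1 := aux_label_lt Γ hnl e.1 (by omega)
        have a2 := aux_label_lt Γ hnl e.2.1 (by omega)
        have b1 := aux_pos_label Γ hnl e.1 (by omega)
        have b2 := aux_pos_label Γ hnl e.2.1 (by omega)
        obtain ⟨a, b, u, s⟩ := e
        simp only at hu1 h1 h3 a1 a2 b1 b2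
        subst hu1 h1
        simp only [id, Function.comp]
        rcases le_total (Γ.label a - 1) (Γ.label b - 1) with h | h
        · rw [min_eq_left h, max_eq_right h, Nat.sub_add_cancel a1.1, Nat.sub_add_cancel a2.1,
            b1, b2, min_eq_left h3.1.le, max_eq_right h3.1.le]
        · rw [min_eq_right h, max_eq_left h, Nat.sub_add_cancel a1.1, Nat.sub_add_cancel a2.1,
            b1, b2, min_eq_right h3.1.le, max_eq_left h3.1.le]
    simp only [gammaA, hR, hk, hRE, hSE]
    rw [← hedges]
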